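/- For every integer v ≥ 61 with v ≡ 1 (mod 12), there exists a 2-(v,4,1) directed design (which has v(v−1)/6 blocks) whose smallest defining sets contain at least (5/8 − 13/(8v))·(v(v−1)/6) blocks. -/

import Mathlib

open scoped Classical

/-- A block of size `k` on the point set `α`: a list of `k` distinct points. -/
def IsBlock {α : Type*} (k : ℕ) (b : List α) : Prop :=
  b.Nodup ∧ b.length = k

/-- A `t-(v,k,λ)` directed design whose point set is the whole (finite) type `α`
(so `v = Fintype.card α`): every ordered `t`-tuple of distinct points appears,
as a subsequence, in exactly `lam` blocks of the multiset `B`. -/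
def IsDD {α : Type*} (t k lam : ℕ) (B : Multiset (List α)) : Prop :=
  (∀ b ∈ B, IsBlock k b) ∧
    ∀ s : List α, s.Nodup → s.length = t →
      B.countP (fun b => s.Sublist b) = lam

/-- `S` is a defining set of the `t-(v,k,λ)` directed design with block multiset `B`:
`S` is a sub-multiset of `B`, and `B` is the unique block multiset of a
`t-(v,k,λ)DD` on the same point set containing `S`. -/
def IsDefiningSet {α : Type*} (t k lam : ℕ) (B S : Multiset (List α)) : Prop :=
  S ≤ B ∧ ∀ B' : Multiset (List α), IsDD t k lam B' → S ≤ B' → B' = B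

/-- A `(v,k,t)` directed trade `T₁ - T₂` of volume `s` on the point set `α`. -/
def IsTrade {α : Type*} (t k s : ℕ) (T₁ T₂ : Multiset (List α)) : Prop :=
  1 ≤ s ∧ Multiset.card T₁ = s ∧ Multiset.card T₂ = s ∧
    (∀ b ∈ T₁, IsBlock k b) ∧ (∀ b ∈ T₂, IsBlock k b) ∧
    (∀ b, b ∈ T₁ → b ∉ T₂) ∧
    ∀ l : List α, l.Nodup → l.length = t →
      T₁.countP (fun b => l.Sublist b) = T₂.countP (fun b => l.Sublist b)

/-- A multiset of blocks is super-simple if any two blocks (any sub-multiset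
consisting of two blocks) intersect, as point sets, in at most two points. -/
def SuperSimple {α : Type*} (B : Multiset (List α)) : Prop :=
  ∀ b₁ b₂ : List α, ({b₁, b₂} : Multiset (List α)) ≤ B →
    (b₁.toFinset ∩ b₂.toFinset).card ≤ 2

/-- A `2-(v,K,1)` design (pairwise balanced design) on the point type `β`. -/
def IsPBD {β : Type*} (K : Set ℕ) (D : Multiset (Finset β)) : Prop :=
  (∀ b ∈ D, b.card ∈ K) ∧
    ∀ x y : β, x ≠ y → D.countP (fun b => x ∈ b ∧ y ∈ b) = 1

/-- A `{K}`-GDD on the point type `β` with group multiset `Gs` and block multiset `Bs`. -/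
def IsGDD {β : Type*} (K : Set ℕ) (Gs Bs : Multiset (Finset β)) : Prop :=
  (∀ x : β, Gs.countP (fun G => x ∈ G) = 1) ∧
    (∀ b ∈ Bs, b.card ∈ K) ∧
    (∀ b ∈ Bs, ∀ G ∈ Gs, (b ∩ G).card ≤ 1) ∧
    (∀ x y : β, x ≠ y → (∀ G ∈ Gs, ¬(x ∈ G ∧ y ∈ G)) →
      Bs.countP (fun b => x ∈ b ∧ y ∈ b) = 1)

/-- A `4`-DGDD on the point type `β` with group multiset `Gs` and block multiset `B`:
the groups partition the points, no block meets a group twice, and every ordered pair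
of points from distinct groups appears in exactly one block. -/
def IsDGDD {β : Type*} (Gs : Multiset (Finset β)) (B : Multiset (List β)) : Prop :=
  (∀ x : β, Gs.countP (fun G => x ∈ G) = 1) ∧
    (∀ b ∈ B, IsBlock 4 b) ∧
    (∀ b ∈ B, ∀ G ∈ Gs, (b.toFinset ∩ G).card ≤ 1) ∧
    (∀ x y : β, x ≠ y → (∀ G ∈ Gs, ¬(x ∈ G ∧ y ∈ G)) →
      B.countP (fun b => [x, y].Sublist b) = 1)

/-- `S` is a defining set of the `4`-DGDD with groups `Gs` and block multiset `B`. -/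
def IsDGDDDefiningSet {β : Type*} (Gs : Multiset (Finset β)) (B S : Multiset (List β)) : Prop :=
  S ≤ B ∧ ∀ B' : Multiset (List β), IsDGDD Gs B' → S ≤ B' → B' = B

/-- The blocks `b` and `c` contain a common pair of points that is adjacent in both of them,
in opposite orders. -/
def AdjRev {α : Type*} (b c : List α) : Prop :=
  ∃ x y, [x, y] <:+: b ∧ [y, x] <:+: c

/-- Every set of blocks which meets all pairs of blocks of `B` with an adjacent reversed pair of
points contains at least `r` blocks of `B`. -/
def Forces {α : Type*} (B : Finset (List α)) (r : ℚ) : Prop :=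
  ∀ S : Finset (List α), (∀ b ∈ B, ∀ c ∈ B, AdjRev b c → b ∈ S ∨ c ∈ S) →
    r ≤ ((B ∩ S).card : ℚ)

/-- The set `E` of ordered pairs can be decomposed into blocks of size `4` which force `r`
blocks. -/
def Good {α : Type*} (E : Set (α × α)) (r : ℚ) : Prop :=
  ∃ B : Finset (List α), (∀ b ∈ B, IsBlock 4 b) ∧
    (∀ b ∈ B, ∀ x y, [x, y].Sublist b → (x, y) ∈ E) ∧
    (∀ x y, (x, y) ∈ E → ∃! b, b ∈ B ∧ [x, y].Sublist b) ∧ Forces B r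

theorem pair_sublist_quad {α : Type*} {x y a b c d : α} :
    [x, y].Sublist [a, b, c, d] ↔ (x = a ∧ y = b) ∨ (x = a ∧ y = c) ∨ (x = a ∧ y = d) ∨
      (x = b ∧ y = c) ∨ (x = b ∧ y = d) ∨ (x = c ∧ y = d) := by
  simp [List.sublist_cons_iff]
  grind

theorem pair_infix_quad {α : Type*} {x y a b c d : α} :
    [x, y] <:+: [a, b, c, d] ↔ (x = a ∧ y = b) ∨ (x = b ∧ y = c) ∨ (x = c ∧ y = d) := by
  simp [List.infix_cons_iff]

theorem IsBlock.exists_quad {α : Type*} {b : List α} (hb : IsBlock 4 b) :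
    ∃ p q r s, b = [p, q, r, s] := by
  have := hb.2
  match b, this with
  | [p, q, r, s], _ => exact ⟨p, q, r, s, rfl⟩

theorem AdjRev.map {α β : Type*} {b c : List α} (f : α → β) (h : AdjRev b c) :
    AdjRev (b.map f) (c.map f) := by
  obtain ⟨x, y, hb, hc⟩ := h
  exact ⟨f x, f y, by simpa using hb.map f, by simpa using hc.map f⟩

theorem Good.mono {α : Type*} {E : Set (α × α)} {r s : ℚ} (h : Good E r) (hs : s ≤ r) :
    Good E s := by
  obtain ⟨B, h1, h2, h3, h4⟩ := h
  exact ⟨B, h1, h2, h3, fun S hS => hs.trans (h4 S hS)⟩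

theorem good_empty {α : Type*} : Good (∅ : Set (α × α)) 0 :=
  ⟨∅, by simp, by simp, by simp, fun S _ => by simp⟩

theorem Good.union {α : Type*} {E F : Set (α × α)} {r s : ℚ} (hE : Good E r) (hF : Good F s)
    (hd : Disjoint E F) : Good (E ∪ F) (r + s) := by
  obtain ⟨B, hB1, hB2, hB3, hB4⟩ := hE
  obtain ⟨C, hC1, hC2, hC3, hC4⟩ := hF
  have hd' : ∀ x y, (x, y) ∈ E → (x, y) ∈ F → False :=
    fun x y h h' => Set.disjoint_left.1 hd h h'
  have hBC : Disjoint B C := by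
    rw [Finset.disjoint_left]
    intro b hb hc
    obtain ⟨p, q, u, v, rfl⟩ := (hB1 b hb).exists_quad
    have : [p, q].Sublist [p, q, u, v] := by simp
    exact hd' p q (hB2 _ hb _ _ this) (hC2 _ hc _ _ this)
  refine ⟨B ∪ C, ?_, ?_, ?_, ?_⟩
  · intro b hb
    exact (Finset.mem_union.1 hb).elim (hB1 b) (hC1 b)
  · intro b hb x y h
    exact (Finset.mem_union.1 hb).imp (fun hb => hB2 b hb x y h) (fun hb => hC2 b hb x y h)
  · rintro x y (h | h)
    · obtain ⟨b, ⟨hb, hxy⟩, hu⟩ := hB3 x y h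
      refine ⟨b, ⟨Finset.mem_union_left _ hb, hxy⟩, fun c ⟨hc, hc'⟩ => ?_⟩
      rcases Finset.mem_union.1 hc with hc | hc
      · exact hu c ⟨hc, hc'⟩
      · exact (hd' x y h (hC2 c hc x y hc')).elim
    · obtain ⟨b, ⟨hb, hxy⟩, hu⟩ := hC3 x y h
      refine ⟨b, ⟨Finset.mem_union_right _ hb, hxy⟩, fun c ⟨hc, hc'⟩ => ?_⟩
      rcases Finset.mem_union.1 hc with hc | hc
      · exact (hd' x y (hB2 c hc x y hc') h).elim
      · exact hu c ⟨hc, hc'⟩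
  · intro S hS
    have h1 := hB4 S fun b hb c hc => hS b (Finset.mem_union_left _ hb) c
      (Finset.mem_union_left _ hc)
    have h2 := hC4 S fun b hb c hc => hS b (Finset.mem_union_right _ hb) c
      (Finset.mem_union_right _ hc)
    rw [Finset.union_inter_distrib_right, Finset.card_union_of_disjoint
      (hBC.mono Finset.inter_subset_left Finset.inter_subset_left)]
    push_cast
    linarith

theorem good_biUnion {α ι : Type*} (s : Finset ι) (E : ι → Set (α × α)) (r : ι → ℚ)
    (h : ∀ i ∈ s, Good (E i) (r i))
    (hd : ∀ i ∈ s, ∀ j ∈ s, i ≠ j → Disjoint (E i) (E j)) :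
    Good (⋃ i ∈ s, E i) (∑ i ∈ s, r i) := by
  induction s using Finset.induction_on with
  | empty => simpa using good_empty
  | insert a s ha ih =>
    rw [Finset.set_biUnion_insert, Finset.sum_insert ha]
    refine (h a (Finset.mem_insert_self a s)).union
      (ih (fun i hi => h i (Finset.mem_insert_of_mem hi))
        fun i hi j hj => hd i (Finset.mem_insert_of_mem hi) j (Finset.mem_insert_of_mem hj)) ?_
    simp only [Set.disjoint_iUnion_right]
    intro i hi
    exact hd a (Finset.mem_insert_self a s) i (Finset.mem_insert_of_mem hi)
      (fun e => ha (e ▸ hi))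

theorem Good.image {α β : Type*} {E : Set (α × α)} {r : ℚ} (h : Good E r) {f : α → β}
    (hf : Function.Injective f) : Good (Prod.map f f '' E) r := by
  obtain ⟨B, h1, h2, h3, h4⟩ := h
  have hm : Function.Injective (List.map f) := List.map_injective_iff.2 hf
  have hsub : ∀ x y b, [f x, f y].Sublist (b.map f) ↔ [x, y].Sublist b := fun x y b =>
    ⟨fun h => by
      obtain ⟨l, hl, hl'⟩ := List.sublist_map_iff.1 h
      have : l = [x, y] := hm (by simpa using hl'.symm)
      exact this ▸ hl, fun h => by simpa using h.map f⟩
  refine ⟨B.image (List.map f), ?_, ?_, ?_, ?_⟩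
  · intro b hb
    obtain ⟨c, hc, rfl⟩ := Finset.mem_image.1 hb
    exact ⟨(h1 c hc).1.map hf, by simpa using (h1 c hc).2⟩
  · intro b hb x y hxy
    obtain ⟨c, hc, rfl⟩ := Finset.mem_image.1 hb
    have hx : x ∈ c.map f := hxy.subset (by simp)
    have hy : y ∈ c.map f := hxy.subset (by simp)
    obtain ⟨x, -, rfl⟩ := List.mem_map.1 hx
    obtain ⟨y, -, rfl⟩ := List.mem_map.1 hy
    exact ⟨(x, y), h2 c hc x y ((hsub x y c).1 hxy), rfl⟩
  · rintro _ _ ⟨⟨x, y⟩, hxy, ⟨⟩⟩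
    obtain ⟨b, ⟨hb, hb'⟩, hu⟩ := h3 x y hxy
    refine ⟨b.map f, ⟨Finset.mem_image_of_mem _ hb, (hsub x y b).2 hb'⟩, ?_⟩
    rintro _ ⟨hm', hc'⟩
    obtain ⟨c, hc, rfl⟩ := Finset.mem_image.1 hm'
    rw [hu c ⟨hc, (hsub x y c).1 hc'⟩]
  · intro S hS
    have := h4 (B.filter fun b => b.map f ∈ S) fun b hb c hc hbc => by
      have := hS _ (Finset.mem_image_of_mem _ hb) _ (Finset.mem_image_of_mem _ hc) (hbc.map f)
      simpa [hb, hc] using this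
    refine this.trans ?_
    rw [← Finset.card_image_of_injective _ hm]
    exact_mod_cast Finset.card_le_card fun b hb => by
      obtain ⟨c, hc, rfl⟩ := Finset.mem_image.1 hb
      simp only [Finset.mem_inter, Finset.mem_filter] at hc
      exact Finset.mem_inter.2 ⟨Finset.mem_image_of_mem _ hc.1, hc.2.2⟩

/-- Reversing an adjacent pair of points of a block changes the order of this pair only. -/
theorem IsBlock.exists_swap {α : Type*} {b : List α} (hb : IsBlock 4 b) {x y : α}
    (h : [x, y] <:+: b) :
    ∃ b', IsBlock 4 b' ∧ b' ≠ b ∧ [x, y].Sublist b ∧ [y, x].Sublist b' ∧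
      ¬ [y, x].Sublist b ∧ ¬ [x, y].Sublist b' ∧
      (∀ u w, (u, w) ≠ (x, y) → (u, w) ≠ (y, x) → ([u, w].Sublist b' ↔ [u, w].Sublist b)) ∧
      ∃ u w, (u, w) ≠ (x, y) ∧ (u, w) ≠ (y, x) ∧ [u, w].Sublist b := by
  obtain ⟨p, q, s, t, rfl⟩ := hb.exists_quad
  have hn := hb.1
  simp only [List.nodup_cons, List.mem_cons, List.not_mem_nil, not_or] at hn
  simp only [pair_infix_quad] at h
  rcases h with ⟨rfl, rfl⟩ | ⟨rfl, rfl⟩ | ⟨rfl, rfl⟩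
  · refine ⟨[y, x, s, t], ⟨?_, rfl⟩, ?_⟩
    · simp only [List.nodup_cons, List.mem_cons, List.not_mem_nil, not_or]; grind
    · simp only [pair_sublist_quad, ne_eq, Prod.mk.injEq]
      refine ⟨by grind, by grind, by grind, by grind, by grind, ?_, s, t, by grind⟩
      grind
  · refine ⟨[p, y, x, t], ⟨?_, rfl⟩, ?_⟩
    · simp only [List.nodup_cons, List.mem_cons, List.not_mem_nil, not_or]; grind
    · simp only [pair_sublist_quad, ne_eq, Prod.mk.injEq]
      refine ⟨by grind, by grind, by grind, by grind, by grind, ?_, p, t, by grind⟩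
      grind
  · refine ⟨[p, q, y, x], ⟨?_, rfl⟩, ?_⟩
    · simp only [List.nodup_cons, List.mem_cons, List.not_mem_nil, not_or]; grind
    · simp only [pair_sublist_quad, ne_eq, Prod.mk.injEq]
      refine ⟨by grind, by grind, by grind, by grind, by grind, ?_, p, q, by grind⟩
      grind

theorem countP_eq_one {α : Type*} {B : Finset (List α)} {p : List α → Prop}
    [DecidablePred p]     (h : ∃! b, b ∈ B ∧ p b) : B.val.countP p = 1 := by
  obtain ⟨b, hb, hu⟩ := h
  rw [Multiset.countP_eq_card_filter]
  change (B.filter p).card = 1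
  rw [Finset.card_eq_one]
  refine ⟨b, Finset.eq_singleton_iff_unique_mem.2 ⟨Finset.mem_filter.2 hb, fun c hc => ?_⟩⟩
  exact hu c (Finset.mem_filter.1 hc)

/-- A defining set meets every pair of blocks in which two adjacent points occur in opposite
orders. -/
theorem IsDefiningSet.mem_or_mem {α : Type*} {B : Finset (List α)} {S : Multiset (List α)}
    (hS : IsDefiningSet 2 4 1 B.val S) (hB : ∀ b ∈ B, IsBlock 4 b)
    (hB' : ∀ x y, x ≠ y → ∃! b, b ∈ B ∧ [x, y].Sublist b) {b c : List α} (hb : b ∈ B)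
    (hc : c ∈ B) (h : AdjRev b c) : b ∈ S ∨ c ∈ S := by
  by_contra! hbc
  obtain ⟨x, y, hx, hy⟩ := h
  obtain ⟨b', hb1, hb2, hb3, hb4, hb5, hb6, hb7, u, w, hu1, hu2, hu3⟩ := (hB b hb).exists_swap hx
  obtain ⟨c', hc1, hc2, hc3, hc4, hc5, hc6, hc7, -⟩ := (hB c hc).exists_swap hy
  have hne : b ≠ c := fun e => hb5 (e ▸ hc3)
  have hxy : x ≠ y := fun e => by subst e; exact hb5 hb3
  set R := (B.erase b).erase c with hR
  have hcB : c ∈ B.erase b := Finset.mem_erase.2 ⟨hne.symm, hc⟩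
  have hBR : B.val = b ::ₘ c ::ₘ R.val := by
    rw [hR, Finset.erase_val, Multiset.cons_erase hcB, Finset.erase_val, Multiset.cons_erase hb]
  have hSR : S ≤ R.val := by
    have := hS.1
    rwa [hBR, Multiset.le_cons_of_notMem hbc.1, Multiset.le_cons_of_notMem hbc.2] at this
  have hD : IsDD 2 4 1 (b' ::ₘ c' ::ₘ R.val) := by
    refine ⟨?_, ?_⟩
    · intro d hd
      rcases Multiset.mem_cons.1 hd with rfl | hd
      · exact hb1
      rcases Multiset.mem_cons.1 hd with rfl | hd
      · exact hc1
      · exact hB d (Finset.mem_of_mem_erase (Finset.mem_of_mem_erase hd))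
    · intro s hs hs2
      obtain ⟨u, w, rfl⟩ := List.length_eq_two.1 hs2
      have huw : u ≠ w := by simpa using hs
      have h1 := countP_eq_one (hB' u w huw)
      rw [hBR] at h1
      rw [← h1]
      simp only [Multiset.countP_cons]
      by_cases e1 : (u, w) = (x, y)
      · obtain ⟨rfl, rfl⟩ := Prod.mk.inj e1
        rw [if_pos hb3, if_neg hc5, if_neg hb6, if_pos hc4]
      by_cases e2 : (u, w) = (y, x)
      · obtain ⟨rfl, rfl⟩ := Prod.mk.inj e2
        rw [if_neg hb5, if_pos hc3, if_pos hb4, if_neg hc6]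
      · simp only [hb7 u w e1 e2, hc7 u w e2 e1]
  have he := hS.2 _ hD ((hSR.trans (Multiset.le_cons_self _ _)).trans (Multiset.le_cons_self _ _))
  have hb'B : b' ∈ B := by
    rw [← Finset.mem_val, ← he]
    exact Multiset.mem_cons_self _ _
  have hb'c : b' = c := (hB' y x hxy.symm).unique ⟨hb'B, hb4⟩ ⟨hc, hc3⟩
  have huw : u ≠ w := by
    rintro rfl
    have := hu3.nodup (hB b hb).1
    simp at this
  exact hb2 ((hB' u w huw).unique ⟨hb'B, (hb7 u w hu1 hu2).2 hu3⟩ ⟨hb, hu3⟩)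

theorem card_pairs {α : Type*} [Fintype α] {b : List α} (hb : IsBlock 4 b) :
    ((Finset.univ : Finset α).offDiag.filter fun p => [p.1, p.2].Sublist b).card = 6 := by
  obtain ⟨p, q, s, t, rfl⟩ := hb.exists_quad
  have hn := hb.1
  simp only [List.nodup_cons, List.mem_cons, List.not_mem_nil, not_or] at hn
  have : ((Finset.univ : Finset α).offDiag.filter fun u => [u.1, u.2].Sublist [p, q, s, t]) =
      {(p, q), (p, s), (p, t), (q, s), (q, t), (s, t)} := by
    ext ⟨x, y⟩
    simp only [Finset.mem_filter, Finset.mem_offDiag, Finset.mem_univ, true_and,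
      pair_sublist_quad, Finset.mem_insert, Finset.mem_singleton, Prod.mk.injEq]
    grind
  rw [this]
  repeat rw [Finset.card_insert_of_notMem (by
    simp only [Finset.mem_insert, Finset.mem_singleton, Prod.mk.injEq]; grind)]
  simp

theorem Good.exists_isDD {α : Type*} [Fintype α] {r : ℚ}
    (h : Good {p : α × α | p.1 ≠ p.2} r) :
    ∃ B : Multiset (List (α)), IsDD 2 4 1 B ∧
      6 * Multiset.card B = Fintype.card α * Fintype.card α - Fintype.card α ∧
      ∀ S : Multiset (List (α)), IsDefiningSet 2 4 1 B S → r ≤ (Multiset.card S : ℚ) := by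
  obtain ⟨B, h1, -, h3, h4⟩ := h
  refine ⟨B.val, ⟨h1, ?_⟩, ?_, ?_⟩
  · intro s hs hs2
    obtain ⟨u, w, rfl⟩ := List.length_eq_two.1 hs2
    exact countP_eq_one (h3 u w (by simpa using hs))
  · have := Finset.sum_card_bipartiteAbove_eq_sum_card_bipartiteBelow
      (s := B) (t := (Finset.univ : Finset (α)).offDiag)
      (fun b p => [p.1, p.2].Sublist b)
    have e1 : ∀ b ∈ B, (Finset.bipartiteAbove (fun (b : List (α)) (p : α × α) =>
        [p.1, p.2].Sublist b) (Finset.univ : Finset (α)).offDiag b).card = 6 := by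
      intro b hb
      rw [Finset.bipartiteAbove]
      exact card_pairs (h1 b hb)
    have e2 : ∀ p ∈ (Finset.univ : Finset (α)).offDiag,
        (Finset.bipartiteBelow (fun (b : List (α)) (p : α × α) =>
        [p.1, p.2].Sublist b) B p).card = 1 := by
      intro p hp
      have := countP_eq_one (h3 p.1 p.2 (by simpa using hp))
      rw [Multiset.countP_eq_card_filter] at this
      exact this
    rw [Finset.sum_congr rfl e1, Finset.sum_congr rfl e2] at this
    simp only [Finset.sum_const, smul_eq_mul, Finset.offDiag_card, Finset.card_univ,
      mul_one] at this
    rw [Finset.card_val, mul_comm, this]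
  · intro S hS
    have := h4 S.toFinset fun b hb c hc hbc => by
      simpa using hS.mem_or_mem h1 h3 hb hc hbc
    refine this.trans ?_
    have h' : (B ∩ S.toFinset).card ≤ Multiset.card S :=
      (Finset.card_le_card Finset.inter_subset_right).trans (Multiset.toFinset_card_le S)
    exact_mod_cast h'

theorem Good.offDiag_congr {α β : Type*} {r : ℚ} (h : Good {p : α × α | p.1 ≠ p.2} r)
    (e : α ≃ β) : Good {p : β × β | p.1 ≠ p.2} r := by
  convert h.image e.injective
  ext ⟨x, y⟩
  constructor
  · intro hxy
    exact ⟨(e.symm x, e.symm y), by simpa using hxy, by simp⟩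
  · rintro ⟨⟨x, y⟩, hxy, ⟨⟩⟩
    simpa using hxy

theorem Good.transversal_congr {ι ι' κ : Type*} {r : ℚ}
    (h : Good {p : (ι × κ) × (ι × κ) | p.1.1 ≠ p.2.1} r) (e : ι ≃ ι') :
    Good {p : (ι' × κ) × (ι' × κ) | p.1.1 ≠ p.2.1} r := by
  convert h.image (e.injective.prodMap (Function.injective_id (α := κ)))
  ext ⟨⟨x, a⟩, ⟨y, b⟩⟩
  constructor
  · intro hxy
    exact ⟨((e.symm x, a), (e.symm y, b)), by simpa using hxy, by simp⟩
  · rintro ⟨⟨⟨x, a⟩, ⟨y, b⟩⟩, hxy, ⟨⟩⟩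
    simpa using hxy

/-- Replace every point of a group divisible design by copies indexed by `κ`, put a good
decomposition on every line, and fill each group together with one new point. -/
theorem good_offDiag_of_lines {Q Λ Γ κ : Type*} [Fintype Λ] [Fintype Γ] (grp : Q → Γ)
    (Inc : Λ → Q → Prop)
    (hline : ∀ p q, grp p ≠ grp q → ∃! l, Inc l p ∧ Inc l q)
    (hgrp : ∀ l p q, Inc l p → Inc l q → grp p = grp q → p = q) (r : Λ → ℚ) (s : Γ → ℚ)
    (hr : ∀ l, Good {p : ({q // Inc l q} × κ) × ({q // Inc l q} × κ) | p.1.1 ≠ p.2.1} (r l))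
    (hs : ∀ g, Good {p : Option ({q // grp q = g} × κ) × Option ({q // grp q = g} × κ) |
      p.1 ≠ p.2} (s g)) :
    Good {p : Option (Q × κ) × Option (Q × κ) | p.1 ≠ p.2} (∑ l, r l + ∑ g, s g) := by
  let E : Λ → Set (Option (Q × κ) × Option (Q × κ)) := fun l =>
    {p | ∃ x a y b, p = (some (x, a), some (y, b)) ∧ x ≠ y ∧ Inc l x ∧ Inc l y}
  let F : Γ → Set (Option (Q × κ) × Option (Q × κ)) := fun g =>
    {p | p.1 ≠ p.2 ∧ (∀ z ∈ p.1, grp z.1 = g) ∧ ∀ z ∈ p.2, grp z.1 = g}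
  have hE : ∀ l, Good (E l) (r l) := by
    intro l
    have hf : Function.Injective
        fun x : {q // Inc l q} × κ => (some (x.1.1, x.2) : Option (Q × κ)) := by
      rintro ⟨⟨x, hx⟩, a⟩ ⟨⟨y, hy⟩, b⟩ h
      simpa using h
    convert (hr l).image hf
    ext p
    constructor
    · rintro ⟨x, a, y, b, rfl, hxy, hx, hy⟩
      exact ⟨((⟨x, hx⟩, a), (⟨y, hy⟩, b)), by simpa using hxy, rfl⟩
    · rintro ⟨⟨⟨⟨x, hx⟩, a⟩, ⟨⟨y, hy⟩, b⟩⟩, hxy, rfl⟩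
      exact ⟨x, a, y, b, rfl, by simpa using hxy, hx, hy⟩
  have hF : ∀ g, Good (F g) (s g) := by
    intro g
    have hf : Function.Injective (Option.map
        fun x : {q // grp q = g} × κ => ((x.1.1, x.2) : Q × κ)) := by
      refine Option.map_injective ?_
      rintro ⟨⟨x, hx⟩, a⟩ ⟨⟨y, hy⟩, b⟩ h
      simpa using h
    have hlift : ∀ z : Option (Q × κ), (∀ w ∈ z, grp w.1 = g) →
        ∃ z' : Option ({q // grp q = g} × κ), z'.map (fun x => ((x.1.1, x.2) : Q × κ)) = z := by
      rintro (_ | ⟨x, a⟩) h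
      · exact ⟨none, rfl⟩
      · exact ⟨some (⟨x, h _ rfl⟩, a), rfl⟩
    convert (hs g).image hf
    ext ⟨p, q⟩
    constructor
    · rintro ⟨hpq, hp, hq⟩
      obtain ⟨p, rfl⟩ := hlift p hp
      obtain ⟨q, rfl⟩ := hlift q hq
      exact ⟨(p, q), fun e => hpq (congrArg (Option.map fun x => ((x.1.1, x.2) : Q × κ)) e), rfl⟩
    · rintro ⟨⟨p, q⟩, hpq, ⟨⟩⟩
      refine ⟨fun e => hpq (hf e), ?_, ?_⟩
      · rintro z hz
        obtain ⟨w, -, rfl⟩ := Option.mem_map.1 hz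
        exact w.1.2
      · rintro z hz
        obtain ⟨w, -, rfl⟩ := Option.mem_map.1 hz
        exact w.1.2
  have hEE := good_biUnion Finset.univ E r (fun l _ => hE l) fun l _ l' _ hll => by
    rw [Set.disjoint_left]
    rintro _ ⟨x, a, y, b, rfl, hxy, hx, hy⟩ ⟨x', a', y', b', h, -, hx', hy'⟩
    simp only [Prod.mk.injEq, Option.some.injEq] at h
    obtain ⟨⟨rfl, rfl⟩, rfl, rfl⟩ := h
    exact hll ((hline x y fun e => hxy (hgrp l x y hx hy e)).unique ⟨hx, hy⟩ ⟨hx', hy'⟩)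
  have hFF := good_biUnion Finset.univ F s (fun l _ => hF l) fun g _ g' _ hgg => by
    rw [Set.disjoint_left]
    rintro ⟨p, q⟩ ⟨hpq, hp, hq⟩ ⟨-, hp', hq'⟩
    rcases p with _ | p
    · rcases q with _ | q
      · exact hpq rfl
      · exact hgg ((hq q rfl).symm.trans (hq' q rfl))
    · exact hgg ((hp p rfl).symm.trans (hp' p rfl))
  convert hEE.union hFF ?_
  · ext ⟨p, q⟩
    simp only [Set.mem_ofPred_eq, Set.mem_union, Set.mem_iUnion, Finset.mem_univ, exists_true_left]
    constructor
    · intro hpq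
      rcases p with _ | ⟨x, a⟩
      · rcases q with _ | ⟨y, b⟩
        · exact (hpq rfl).elim
        · exact Or.inr ⟨grp y, hpq, by simp, by simp⟩
      · rcases q with _ | ⟨y, b⟩
        · exact Or.inr ⟨grp x, hpq, by simp, by simp⟩
        · by_cases hg : grp x = grp y
          · exact Or.inr ⟨grp x, hpq, by simp, by simp [hg]⟩
          · obtain ⟨l, ⟨hx, hy⟩, -⟩ := hline x y hg
            exact Or.inl ⟨l, x, a, y, b, rfl, fun e => hg (congrArg grp e), hx, hy⟩
    · rintro (⟨l, x, a, y, b, h, hxy, -, -⟩ | ⟨g, hpq, -, -⟩)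
      · obtain ⟨rfl, rfl⟩ := Prod.mk.inj h
        simpa using fun e => (hxy e).elim
      · exact hpq
  · simp only [Set.disjoint_iUnion_left, Set.disjoint_iUnion_right]
    rintro g - l -
    rw [Set.disjoint_left]
    rintro _ ⟨x, a, y, b, rfl, hxy, hx, hy⟩ ⟨-, h1, h2⟩
    exact hxy (hgrp l x y hx hy ((h1 _ rfl).trans (h2 _ rfl).symm))

/-- The truncated transversal design on four copies of a ring and a subset of a fifth one. -/
theorem good_offDiag_transversal {R κ : Type*} [CommRing R] [Fintype R] [Fintype κ] (c : Fin 4 → R)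
    (hc : ∀ i j, i ≠ j → IsUnit (c i - c j)) (U : Finset R) {r₄ r₅ s t : ℚ}
    (h4 : Good {p : (Fin 4 × κ) × (Fin 4 × κ) | p.1.1 ≠ p.2.1} r₄)
    (h5 : Good {p : (Fin 5 × κ) × (Fin 5 × κ) | p.1.1 ≠ p.2.1} r₅)
    (hs : Good {p : Option (R × κ) × Option (R × κ) | p.1 ≠ p.2} s)
    (ht : Good {p : Option (U × κ) × Option (U × κ) | p.1 ≠ p.2} t) :
    Good {p : Option ((Fin 4 × R ⊕ U) × κ) × Option ((Fin 4 × R ⊕ U) × κ) | p.1 ≠ p.2}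
      (Fintype.card R * ((Fintype.card R - U.card) * r₄ + U.card * r₅) + (4 * s + t)) := by
  let grp : (Fin 4 × R ⊕ U) → Option (Fin 4) := Sum.elim (fun x => some x.1) fun _ => none
  let Inc : R × R → (Fin 4 × R ⊕ U) → Prop := fun l =>
    Sum.elim (fun x => x.2 = l.1 + l.2 * c x.1) fun u => u.1 = l.2
  have key := good_offDiag_of_lines (κ := κ) grp Inc ?_ ?_
    (fun l => if l.2 ∈ U then r₅ else r₄) (fun g => g.elim t fun _ => s) ?_ ?_
  · convert key using 1
    have hU [DecidablePred (· ∈ U)] : ∑ b : R, (if b ∈ U then r₅ else r₄) =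
        (Fintype.card R - U.card) * r₄ + U.card * r₅ := by
      rw [Finset.sum_ite]
      simp [Finset.filter_not, ← Finset.compl_eq_univ_sdiff,
        Finset.card_compl, Nat.cast_sub (Finset.card_le_univ U)]
      ring
    rw [Fintype.sum_prod_type]
    simp only [hU, Fintype.sum_option]
    simp
    ring
  · rintro (⟨i, x⟩ | ⟨u, hu⟩) (⟨j, y⟩ | ⟨w, hw⟩) hg
    · have hij : i ≠ j := fun e => hg (by simp [grp, e])
      obtain ⟨d, hd⟩ := hc i j hij
      refine ⟨(x - (↑d⁻¹ * (x - y)) * c i, ↑d⁻¹ * (x - y)), ?_, ?_⟩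
      · simp only [Inc, Sum.elim_inl]
        refine ⟨by ring, ?_⟩
        have : (d : R) * ↑d⁻¹ = 1 := d.mul_inv
        rw [hd] at this
        linear_combination (x - y) * this
      · rintro ⟨a, b⟩ ⟨h1, h2⟩
        simp only [Inc, Sum.elim_inl] at h1 h2
        have hb : b = ↑d⁻¹ * (x - y) := by
          rw [h1, h2]
          have : (↑d⁻¹ : R) * d = 1 := d.inv_mul
          rw [hd] at this
          linear_combination -b * this
        rw [← hb, h1]
        simp
    · refine ⟨(x - w * c i, w), by simp [Inc], ?_⟩
      rintro ⟨a, b⟩ ⟨h1, h2⟩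
      simp only [Inc, Sum.elim_inl, Sum.elim_inr] at h1 h2
      simp [h1, h2]
    · refine ⟨(y - u * c j, u), by simp [Inc], ?_⟩
      rintro ⟨a, b⟩ ⟨h1, h2⟩
      simp only [Inc, Sum.elim_inl, Sum.elim_inr] at h1 h2
      simp [h1, h2]
    · exact (hg rfl).elim
  · rintro ⟨a, b⟩ (⟨i, x⟩ | ⟨u, hu⟩) (⟨j, y⟩ | ⟨w, hw⟩) h1 h2 hg
    · simp only [grp, Inc, Sum.elim_inl, Option.some.injEq] at h1 h2 hg
      simp [h1, h2, hg]
    · simp [grp] at hg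
    · simp [grp] at hg
    · simp only [Inc, Sum.elim_inr] at h1 h2
      simp [h1, h2]
  · rintro ⟨a, b⟩
    dsimp only
    split_ifs with hb
    · refine h5.transversal_congr ((finSuccEquiv 4).trans ?_)
      refine Equiv.ofBijective (fun o => o.elim ⟨Sum.inr ⟨b, hb⟩, rfl⟩
        fun i => ⟨Sum.inl (i, a + b * c i), rfl⟩) ⟨?_, ?_⟩
      · rintro (_ | i) (_ | j) h <;> simp_all [Subtype.ext_iff]
      · rintro ⟨⟨i, x⟩ | ⟨u, hu⟩, h⟩
        · exact ⟨some i, Subtype.ext (by simpa [Inc] using h.symm)⟩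
        · exact ⟨none, Subtype.ext (by simpa [Inc] using h.symm)⟩
    · refine h4.transversal_congr (Equiv.ofBijective
        (fun i => ⟨Sum.inl (i, a + b * c i), rfl⟩) ⟨?_, ?_⟩)
      · intro i j h
        simp_all [Subtype.ext_iff]
      · rintro ⟨⟨i, x⟩ | ⟨u, hu⟩, h⟩
        · exact ⟨i, Subtype.ext (by simpa [Inc] using h.symm)⟩
        · simp only [Inc, Sum.elim_inr] at h
          exact (hb (h ▸ hu)).elim
  · rintro (_ | i)
    · refine ht.offDiag_congr (Equiv.optionCongr (Equiv.prodCongr ?_ (Equiv.refl κ)))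
      refine Equiv.ofBijective (fun u => ⟨Sum.inr u, rfl⟩) ⟨?_, ?_⟩
      · intro u w h
        simpa using congrArg Subtype.val h
      · rintro ⟨⟨i, x⟩ | u, h⟩
        · simp [grp] at h
        · exact ⟨u, rfl⟩
    · refine hs.offDiag_congr (Equiv.optionCongr (Equiv.prodCongr ?_ (Equiv.refl κ)))
      refine Equiv.ofBijective (fun x => ⟨Sum.inl (i, x), rfl⟩) ⟨?_, ?_⟩
      · intro u w h
        simpa using congrArg Subtype.val h
      · rintro ⟨⟨j, x⟩ | u, h⟩
        · simp only [grp, Sum.elim_inl, Option.some.injEq] at h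
          exact ⟨x, Subtype.ext (by simp [h])⟩
        · simp [grp] at h

/-- The ordered pairs of entries of a list, in the order of the list. -/
def orderedPairs {α : Type*} : List α → List (α × α)
  | [] => []
  | a :: l => l.map (Prod.mk a) ++ orderedPairs l

theorem mem_orderedPairs {α : Type*} {x y : α} {l : List α} :
    (x, y) ∈ orderedPairs l ↔ [x, y].Sublist l := by
  induction l with
  | nil => simp [orderedPairs]
  | cons a l ih =>
    simp only [orderedPairs, List.mem_append, List.mem_map, Prod.mk.injEq, ih,
      List.sublist_cons_iff (l := [x, y])]
    simp
    grind

theorem infix_of_mem_zip_tail {α : Type*} {x y : α} {l : List α} (h : (x, y) ∈ l.zip l.tail) :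
    [x, y] <:+: l := by
  induction l with
  | nil => simp at h
  | cons a l ih =>
    cases l with
    | nil => simp at h
    | cons b l =>
      simp only [List.tail_cons, List.zip_cons_cons, List.mem_cons, Prod.mk.injEq] at h
      rcases h with ⟨rfl, rfl⟩ | h
      · exact (List.prefix_append [x, y] l).isInfix
      · exact (ih h).trans (List.suffix_cons a _).isInfix

/-- Base blocks over the integers modulo `N` which, developed by the multiples of `g`, cover every
ordered pair of points whose difference is not a multiple of `h` exactly once.  The base blocks are
arranged in lists of blocks which pairwise contain a reversed adjacent pair. -/
structure IsDiffFamily (N h g : ℕ) (G : List (List (List ℕ))) : Prop where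
  length_eq : ∀ b ∈ G.flatten, b.length = 4
  nodup : G.flatten.Nodup
  perm : (G.flatten.flatMap fun b => (orderedPairs b).map
    fun p => (p.1 % g, (p.2 + (N - p.1 % N)) % N)).Perm
      ((List.range g ×ˢ List.range N).filter fun q => q.2 % h != 0)
  pairwise : ∀ c ∈ G, c.Pairwise fun b b' => ∃ p ∈ b.zip b.tail, p.swap ∈ b'.zip b'.tail

instance (N h g : ℕ) (G : List (List (List ℕ))) : Decidable (IsDiffFamily N h g G) :=
  decidable_of_iff ((∀ b ∈ G.flatten, b.length = 4) ∧ G.flatten.Nodup ∧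
    (G.flatten.flatMap fun b => (orderedPairs b).map
      fun p => (p.1 % g, (p.2 + (N - p.1 % N)) % N)).Perm
        ((List.range g ×ˢ List.range N).filter fun q => q.2 % h != 0) ∧
    ∀ c ∈ G, c.Pairwise fun b b' => ∃ p ∈ b.zip b.tail, p.swap ∈ b'.zip b'.tail)
    ⟨fun h => ⟨h.1, h.2.1, h.2.2.1, h.2.2.2⟩, fun h => ⟨h.1, h.2, h.3, h.4⟩⟩

theorem ZMod.card_filter_castHom_eq_zero {N g : ℕ} [NeZero N] (hg : g ∣ N) :
    (Finset.univ.filter fun z : ZMod N => ZMod.castHom hg (ZMod g) z = 0).card = N / g := by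
  have hg0 : 0 < g := Nat.pos_of_dvd_of_pos hg (NeZero.pos N)
  obtain ⟨n, hn⟩ := hg
  have h : (Finset.univ.filter fun z : ZMod N => ZMod.castHom ⟨n, hn⟩ (ZMod g) z = 0) =
      (Finset.range n).image fun t => ((g * t : ℕ) : ZMod N) := by
    ext z
    simp only [Finset.mem_filter, Finset.mem_univ, true_and, Finset.mem_image, Finset.mem_range]
    constructor
    · intro hz
      rw [← ZMod.natCast_zmod_val z, map_natCast, ZMod.natCast_eq_zero_iff] at hz
      obtain ⟨t, ht⟩ := hz
      refine ⟨t, ?_, by rw [← ht, ZMod.natCast_zmod_val]⟩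
      have := z.val_lt
      rw [ht, hn] at this
      exact Nat.lt_of_mul_lt_mul_left this
    · rintro ⟨t, -, rfl⟩
      rw [map_natCast]
      simp
  rw [h, Finset.card_image_of_injOn, Finset.card_range, hn, Nat.mul_div_cancel_left _ hg0]
  intro a ha b hb hab
  have hlt : ∀ a ∈ Finset.range n, g * a < N := fun a ha => by
    rw [hn]; exact Nat.mul_lt_mul_of_pos_left (Finset.mem_range.1 ha) hg0
  have := congrArg ZMod.val hab
  simp only at this
  rw [ZMod.val_cast_of_lt (hlt a ha), ZMod.val_cast_of_lt (hlt b hb)] at this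
  exact Nat.eq_of_mul_eq_mul_left hg0 this

theorem IsDiffFamily.good {N h g : ℕ} {G : List (List (List ℕ))} [NeZero N] (hh : h ∣ N)
    (hg : g ∣ N) (H : IsDiffFamily N h g G) :
    Good {p : ZMod N × ZMod N | ZMod.castHom hh (ZMod h) p.1 ≠ ZMod.castHom hh (ZMod h) p.2}
      ((N / g : ℕ) * (G.flatten.length - G.length)) := by
  let T : Finset (ZMod N) := Finset.univ.filter fun z => ZMod.castHom hg (ZMod g) z = 0
  have hT : T.card = N / g := ZMod.card_filter_castHom_eq_zero hg
  have hT' : ∀ z, z ∈ T ↔ ZMod.castHom hg (ZMod g) z = 0 := fun z => by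
    simp only [T, Finset.mem_filter, Finset.mem_univ, true_and]
  let f : ZMod N → ℕ → ZMod N := fun z a => a + z
  let tr : ZMod N × List ℕ → List (ZMod N) := fun q => q.2.map (f q.1)
  let key : ℕ × ℕ → ℕ × ℕ := fun p => (p.1 % g, (p.2 + (N - p.1 % N)) % N)
  let P : List (List ℕ × (ℕ × ℕ)) := G.flatten.flatMap fun b => (orderedPairs b).map (Prod.mk b)
  have hkey2 : ∀ p : ℕ × ℕ, ((key p).2 : ZMod N) = p.2 - p.1 := by
    intro p
    simp only [key]
    rw [ZMod.natCast_mod, Nat.cast_add, Nat.cast_sub (Nat.mod_lt _ (NeZero.pos N)).le,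
      ZMod.natCast_mod, ZMod.natCast_self]
    ring
  have hsub : ∀ x y z b, [x, y].Sublist (tr (z, b)) →
      ∃ p, (p.1 : ZMod N) + z = x ∧ (p.2 : ZMod N) + z = y ∧ p ∈ orderedPairs b := by
    intro x y z b hxy
    obtain ⟨l, hl, hl'⟩ := List.sublist_map_iff.1 hxy
    match l, hl' with
    | [u, w], hl' =>
      simp only [List.map_cons, List.map_nil, List.cons.injEq, and_true] at hl'
      exact ⟨(u, w), hl'.1.symm, hl'.2.symm, mem_orderedPairs.2 hl⟩
  have hP : P.map (fun q => key q.2) = G.flatten.flatMap fun b => (orderedPairs b).map key := by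
    simp [P, List.map_flatMap, Function.comp_def]
  have hmemP : ∀ b ∈ G.flatten, ∀ p ∈ orderedPairs b, (b, p) ∈ P := fun b hb p hp =>
    List.mem_flatMap.2 ⟨b, hb, List.mem_map.2 ⟨p, hp, rfl⟩⟩
  have hnd : (P.map fun q => key q.2).Nodup := by
    rw [hP, H.perm.nodup_iff]
    exact (List.nodup_range.product List.nodup_range).filter _
  have hmem : ∀ q, q ∈ P.map (fun q => key q.2) ↔ q.1 < g ∧ q.2 < N ∧ q.2 % h ≠ 0 := by
    rintro ⟨a, d⟩
    rw [hP, H.perm.mem_iff]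
    simp [and_assoc]
  have hE : ∀ b ∈ G.flatten, ∀ z x y, [x, y].Sublist (tr (z, b)) →
      ZMod.castHom hh (ZMod h) x ≠ ZMod.castHom hh (ZMod h) y := by
    intro b hb z x y hxy e
    obtain ⟨p, rfl, rfl, hp⟩ := hsub x y z b hxy
    have h1 := (hmem (key p)).1 (List.mem_map.2 ⟨_, hmemP b hb p hp, rfl⟩)
    refine h1.2.2 (Nat.mod_eq_zero_of_dvd ?_)
    rw [← ZMod.natCast_eq_zero_iff, ← map_natCast (ZMod.castHom hh (ZMod h)), hkey2, map_sub,
      sub_eq_zero]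
    simpa only [map_add, add_left_inj] using e.symm
  have huniq : ∀ b ∈ G.flatten, ∀ b' ∈ G.flatten, ∀ z ∈ T, ∀ z' ∈ T, ∀ x y,
      [x, y].Sublist (tr (z, b)) → [x, y].Sublist (tr (z', b')) → (z, b) = (z', b') := by
    intro b hb b' hb' z hz z' hz' x y hxy hxy'
    obtain ⟨p, rfl, rfl, hp⟩ := hsub x y z b hxy
    obtain ⟨p', h1, h2, hp'⟩ := hsub _ _ z' b' hxy'
    have hk : key p = key p' := by
      refine Prod.ext ?_ ?_
      · change p.1 % g = p'.1 % g
        have := congrArg (ZMod.castHom hg (ZMod g)) h1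
        rw [map_add, map_add, (hT' z).1 hz, (hT' z').1 hz', map_natCast, map_natCast, add_zero,
          add_zero, ZMod.natCast_eq_natCast_iff'] at this
        exact this.symm
      · have e : ((key p).2 : ZMod N) = (key p').2 := by
          rw [hkey2, hkey2]
          linear_combination h1 - h2
        rw [ZMod.natCast_eq_natCast_iff'] at e
        simpa [key] using e
    have := List.inj_on_of_nodup_map hnd (hmemP b hb p hp) (hmemP b' hb' p' hp') hk
    obtain ⟨rfl, rfl⟩ := Prod.mk.inj this
    rw [add_left_cancel h1]
  have hblock : ∀ b ∈ G.flatten, ∀ z, IsBlock 4 (tr (z, b)) := by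
    intro b hb z
    refine ⟨List.nodup_iff_sublist.2 fun a ha => hE b hb z a a ha rfl, ?_⟩
    simpa [tr] using H.length_eq b hb
  have hinj : Set.InjOn tr (T ×ˢ G.flatten.toFinset : Finset _) := by
    rintro ⟨z, b⟩ hb ⟨z', b'⟩ hb' h
    simp only [Finset.coe_product, Set.mem_prod, Finset.mem_coe, List.mem_toFinset] at hb hb'
    obtain ⟨u, w, s, t, e⟩ := (hblock b hb.2 z).exists_quad
    have : [u, w].Sublist (tr (z, b)) := by simp [e]
    exact huniq b hb.2 b' hb'.2 z hb.1 z' hb'.1 u w this (h ▸ this)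
  refine ⟨(T ×ˢ G.flatten.toFinset).image tr, ?_, ?_, ?_, ?_⟩
  · intro b hb
    obtain ⟨⟨z, b⟩, hq, rfl⟩ := Finset.mem_image.1 hb
    exact hblock b (List.mem_toFinset.1 (Finset.mem_product.1 hq).2) z
  · intro b hb x y hxy
    obtain ⟨⟨z, b⟩, hq, rfl⟩ := Finset.mem_image.1 hb
    exact hE b (List.mem_toFinset.1 (Finset.mem_product.1 hq).2) z x y hxy
  · intro x y hxy
    refine existsUnique_of_exists_of_unique ?_ ?_
    · have h1 : (x.val % g, (y - x).val) ∈ P.map fun q => key q.2 := by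
        refine (hmem _).2 ⟨Nat.mod_lt _ (Nat.pos_of_dvd_of_pos hg (NeZero.pos N)),
          ZMod.val_lt _, fun e => hxy ?_⟩
        rw [← Nat.dvd_iff_mod_eq_zero, ← ZMod.natCast_eq_zero_iff,
          ← map_natCast (ZMod.castHom hh (ZMod h)), ZMod.natCast_zmod_val, map_sub,
          sub_eq_zero] at e
        exact e.symm
      obtain ⟨⟨b, p⟩, hbp, hk⟩ := List.mem_map.1 h1
      obtain ⟨b, hb, hp⟩ := List.mem_flatMap.1 hbp
      obtain ⟨p, hp', he⟩ := List.mem_map.1 hp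
      obtain ⟨rfl, rfl⟩ := Prod.mk.inj he
      replace hk : key p = (x.val % g, (y - x).val) := hk
      have hd : (p.2 : ZMod N) - p.1 = y - x := by
        rw [← hkey2, hk, ZMod.natCast_zmod_val]
      refine ⟨tr (x - p.1, b), Finset.mem_image_of_mem _ (Finset.mem_product.2
        ⟨(hT' _).2 ?_, List.mem_toFinset.2 hb⟩), ?_⟩
      · have : p.1 % g = x.val % g := congrArg Prod.fst hk
        rw [map_sub, map_natCast, ← ZMod.natCast_zmod_val x, map_natCast, sub_eq_zero,
          ZMod.natCast_eq_natCast_iff']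
        exact this.symm
      · have := (mem_orderedPairs.1 hp').map (f (x - p.1))
        simp only [List.map_cons, List.map_nil, f] at this
        rwa [add_sub_cancel, show (p.2 : ZMod N) + (x - p.1) = y by linear_combination hd] at this
    · rintro b b' ⟨hb, hxy⟩ ⟨hb', hxy'⟩
      obtain ⟨⟨z, b⟩, hq, rfl⟩ := Finset.mem_image.1 hb
      obtain ⟨⟨z', b'⟩, hq', rfl⟩ := Finset.mem_image.1 hb'
      rw [Finset.mem_product, List.mem_toFinset] at hq hq'
      rw [huniq b hq.2 b' hq'.2 z hq.1 z' hq'.1 x y hxy hxy']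
  · intro S hS
    have hcard : ((T ×ˢ G.flatten.toFinset).image tr).card = N / g * G.flatten.length := by
      rw [Finset.card_image_of_injOn hinj, Finset.card_product, hT,
        List.toFinset_card_of_nodup H.nodup]
    have hadj : ∀ c ∈ G, ∀ z, ∀ b ∈ c, ∀ b' ∈ c, b ≠ b' → AdjRev (tr (z, b)) (tr (z, b')) := by
      intro c hc z b hb b' hb' hbb
      have : Std.Symm fun b b' : List ℕ => AdjRev b b' :=
        ⟨fun b b' ⟨x, y, h, h'⟩ => ⟨y, x, h', h⟩⟩
      refine AdjRev.map (f z) (((H.pairwise c hc).imp ?_).forall hb hb' hbb)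
      rintro b b' ⟨⟨x, y⟩, h, h'⟩
      exact ⟨x, y, infix_of_mem_zip_tail h, infix_of_mem_zip_tail h'⟩
    have hle : ((T ×ˢ G.flatten.toFinset).image tr \ S).card ≤ N / g * G.length := by
      calc _ ≤ ((T ×ˢ G.toFinset).biUnion fun q =>
            (q.2.toFinset.image fun b => tr (q.1, b)) \ S).card := by
              refine Finset.card_le_card fun b hb => ?_
              obtain ⟨hb, hbS⟩ := Finset.mem_sdiff.1 hb
              obtain ⟨⟨z, b⟩, hq, rfl⟩ := Finset.mem_image.1 hb
              rw [Finset.mem_product, List.mem_toFinset, List.mem_flatten] at hq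
              obtain ⟨hz, c, hc, hb⟩ := hq
              exact Finset.mem_biUnion.2 ⟨(z, c), Finset.mem_product.2 ⟨hz, List.mem_toFinset.2 hc⟩,
                Finset.mem_sdiff.2 ⟨Finset.mem_image.2 ⟨b, List.mem_toFinset.2 hb, rfl⟩, hbS⟩⟩
        _ ≤ ∑ q ∈ T ×ˢ G.toFinset, 1 := by
              refine Finset.card_biUnion_le.trans (Finset.sum_le_sum ?_)
              rintro ⟨z, c⟩ hq
              rw [Finset.mem_product, List.mem_toFinset] at hq
              refine Finset.card_le_one.2 ?_
              intro b hb b' hb'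
              obtain ⟨hb, hbS⟩ := Finset.mem_sdiff.1 hb
              obtain ⟨hb', hbS'⟩ := Finset.mem_sdiff.1 hb'
              obtain ⟨b, hbc, rfl⟩ := Finset.mem_image.1 hb
              obtain ⟨b', hbc', rfl⟩ := Finset.mem_image.1 hb'
              replace hbc := List.mem_toFinset.1 hbc
              replace hbc' := List.mem_toFinset.1 hbc'
              by_contra hbb
              have hB : ∀ b ∈ c, tr (z, b) ∈ (T ×ˢ G.flatten.toFinset).image tr := fun b hb =>
                Finset.mem_image_of_mem _ (Finset.mem_product.2
                  ⟨hq.1, List.mem_toFinset.2 (List.mem_flatten.2 ⟨c, hq.2, hb⟩)⟩)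
              exact (hS _ (hB b hbc) _ (hB b' hbc') (hadj c hq.2 z b hbc b' hbc'
                fun e => hbb (by rw [e]))).elim hbS hbS'
        _ ≤ N / g * G.length := by
              rw [Finset.sum_const, smul_eq_mul, mul_one, Finset.card_product, hT]
              exact Nat.mul_le_mul_left _ (List.toFinset_card_le G)
    have hsum := Finset.card_inter_add_card_sdiff ((T ×ˢ G.flatten.toFinset).image tr) S
    rw [hcard] at hsum
    have h1 : ((N / g * G.flatten.length : ℕ) : ℚ) ≤
        (((T ×ˢ G.flatten.toFinset).image tr ∩ S).card + N / g * G.length : ℕ) := by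
      exact_mod_cast hsum ▸ Nat.add_le_add_left hle _
    push_cast at h1
    have h2 : ((N / g : ℕ) : ℚ) * (G.flatten.length - G.length) ≤
        (((T ×ˢ G.flatten.toFinset).image tr ∩ S).card : ℚ) := by linarith
    convert h2

/-- A directed design on `6 * k + 1` points forcing `r` blocks exists. -/
def GoodDesign (k : ℕ) (r : ℚ) : Prop :=
  Good {p : Fin (6 * k + 1) × Fin (6 * k + 1) | p.1 ≠ p.2} r

theorem GoodDesign.of_card {α : Type*} [Fintype α] {k : ℕ} {r : ℚ}
    (h : Good {p : α × α | p.1 ≠ p.2} r) (hc : Fintype.card α = 6 * k + 1) : GoodDesign k r :=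
  h.offDiag_congr (Fintype.equivFinOfCardEq hc)

theorem GoodDesign.to_card {α : Type*} [Fintype α] {k : ℕ} {r : ℚ}
    (h : GoodDesign k r) (hc : Fintype.card α = 6 * k + 1) : Good {p : α × α | p.1 ≠ p.2} r :=
  h.offDiag_congr (Fintype.equivFinOfCardEq hc).symm

theorem IsDiffFamily.goodDesign {k g : ℕ} {G : List (List (List ℕ))}
    (H : IsDiffFamily (6 * k + 1) (6 * k + 1) g G) (hg : g ∣ 6 * k + 1) :
    GoodDesign k (((6 * k + 1) / g : ℕ) * (G.flatten.length - G.length)) := by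
  refine GoodDesign.of_card (α := ZMod (6 * k + 1)) ?_ (ZMod.card _)
  convert H.good dvd_rfl hg using 2
  simp [ZMod.castHom_self]

theorem IsDiffFamily.good_transversal {h n g : ℕ} [NeZero h] [NeZero n]
    {G : List (List (List ℕ))} (H : IsDiffFamily (h * n) h g G) (hg : g ∣ h * n) :
    Good {p : (Fin h × Fin n) × (Fin h × Fin n) | p.1.1 ≠ p.2.1}
      ((h * n / g : ℕ) * (G.flatten.length - G.length)) := by
  have : NeZero (h * n) := ⟨mul_ne_zero (NeZero.ne h) (NeZero.ne n)⟩
  have hh : h ∣ h * n := dvd_mul_right h n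
  let φ := ZMod.castHom hh (ZMod h)
  let f : ZMod (h * n) → ZMod h × Fin n := fun z =>
    (φ z, ⟨z.val / h, Nat.div_lt_of_lt_mul z.val_lt⟩)
  have hf : Function.Bijective f := by
    refine (Fintype.bijective_iff_injective_and_card f).2 ⟨fun x y hxy => ?_, by simp⟩
    have h1 := congrArg Prod.fst hxy
    have h2 := congrArg (fun q => q.2.val) hxy
    simp only [f] at h1 h2
    rw [← ZMod.natCast_zmod_val x, ← ZMod.natCast_zmod_val y, map_natCast, map_natCast,
      ZMod.natCast_eq_natCast_iff'] at h1
    refine ZMod.val_injective _ ?_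
    rw [← Nat.div_add_mod x.val h, ← Nat.div_add_mod y.val h, h1, h2]
  have := (H.good hh hg).image hf.injective
  refine Good.transversal_congr (ι := ZMod h) ?_ (ZMod.finEquiv h).symm.toEquiv
  convert this
  ext ⟨x, y⟩
  obtain ⟨x, rfl⟩ := hf.surjective x
  obtain ⟨y, rfl⟩ := hf.surjective y
  constructor
  · intro hxy
    exact ⟨(x, y), hxy, rfl⟩
  · rintro ⟨⟨x', y'⟩, hxy, e⟩
    obtain ⟨e1, e2⟩ := Prod.mk.inj e
    rw [← hf.injective e1, ← hf.injective e2]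
    exact hxy

theorem good_transversal_four :
    Good {p : (Fin 4 × Fin 6) × (Fin 4 × Fin 6) | p.1.1 ≠ p.2.1} 48 := by
  have H : IsDiffFamily (4 * 6) 4 4
      [[[17, 16, 11, 10], [18, 5, 11, 16], [8, 10, 11, 5]],
       [[20, 2, 11, 1], [17, 2, 20, 7], [11, 2, 17, 12]],
       [[12, 19, 21, 2], [22, 19, 12, 5], [21, 19, 22, 4]],
       [[9, 11, 22, 0], [12, 1, 22, 11], [3, 0, 22, 1]]] := by
    decide +kernel
  exact (H.good_transversal (by decide)).mono (by norm_num)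

theorem good_transversal_five :
    Good {p : (Fin 5 × Fin 6) × (Fin 5 × Fin 6) | p.1.1 ≠ p.2.1} 75 := by
  have H : IsDiffFamily (5 * 6) 5 2
      [[[19, 7, 3, 10], [16, 7, 19, 18], [3, 7, 16, 4]],
       [[11, 9, 28, 17], [2, 9, 11, 3], [28, 9, 2, 25]], [[6, 22, 0, 28], [22, 6, 18, 5]]] := by
    decide +kernel
  exact (H.good_transversal (by decide)).mono (by norm_num)

theorem goodDesign_1 : GoodDesign 1 0 := by
  have H : IsDiffFamily (6 * 1 + 1) (6 * 1 + 1) 7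
      [[[0, 1, 2, 3]], [[1, 5, 0, 4]], [[5, 3, 1, 6]], [[2, 0, 6, 5]], [[6, 2, 4, 1]],
       [[4, 6, 3, 0]], [[3, 4, 5, 2]]] := by
    decide +kernel
  exact (H.goodDesign (by decide)).mono (by norm_num)

theorem goodDesign_2 : GoodDesign 2 13 := by
  have H : IsDiffFamily (6 * 2 + 1) (6 * 2 + 1) 1
      [[[2, 0, 5, 6], [0, 2, 10, 9]]] := by
    decide +kernel
  exact (H.goodDesign (by decide)).mono (by norm_num)

theorem goodDesign_3 : GoodDesign 3 38 := by
  have H : IsDiffFamily (6 * 3 + 1) (6 * 3 + 1) 1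
      [[[13, 0, 10, 2], [15, 0, 13, 14], [10, 0, 15, 3]]] := by
    decide +kernel
  exact (H.goodDesign (by decide)).mono (by norm_num)

theorem goodDesign_4 : GoodDesign 4 52 := by
  have H : IsDiffFamily (6 * 4 + 1) (6 * 4 + 1) 25
      [[[3, 12, 13, 6], [8, 13, 12, 4], [6, 13, 8, 19]],
       [[4, 13, 14, 7], [9, 14, 13, 5], [7, 14, 9, 20]],
       [[5, 14, 15, 8], [10, 15, 14, 6], [8, 15, 10, 21]],
       [[6, 15, 16, 9], [11, 16, 15, 7], [9, 16, 11, 22]],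
       [[9, 18, 19, 12], [14, 19, 18, 10], [12, 19, 14, 0]],
       [[10, 19, 20, 13], [15, 20, 19, 11], [13, 20, 15, 1]],
       [[12, 21, 22, 15], [17, 22, 21, 13], [15, 22, 17, 3]],
       [[13, 22, 23, 16], [18, 23, 22, 14], [16, 23, 18, 4]],
       [[14, 23, 24, 17], [19, 24, 23, 15], [17, 24, 19, 5]],
       [[16, 0, 1, 19], [21, 1, 0, 17], [19, 1, 21, 7]],
       [[17, 1, 2, 20], [22, 2, 1, 18], [20, 2, 22, 8]],
       [[3, 19, 4, 22], [23, 2, 19, 3], [4, 19, 2, 16]],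
       [[20, 4, 5, 23], [0, 5, 4, 21], [23, 5, 0, 11]],
       [[21, 5, 6, 24], [1, 6, 5, 22], [24, 6, 1, 12]],
       [[22, 6, 7, 0], [2, 7, 6, 23], [0, 7, 2, 13]],
       [[2, 11, 12, 5], [7, 12, 11, 3], [5, 12, 7, 18]], [[7, 17, 16, 10], [17, 7, 15, 4]],
       [[8, 17, 11, 18], [12, 16, 17, 8]], [[11, 20, 14, 21], [21, 14, 16, 2]],
       [[15, 0, 24, 18], [20, 24, 0, 16]], [[18, 3, 2, 21], [3, 18, 1, 15]],
       [[23, 7, 8, 1], [1, 8, 3, 14]], [[24, 8, 9, 2], [2, 9, 4, 15]],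
       [[0, 9, 10, 3], [5, 10, 9, 1]], [[1, 11, 10, 4], [6, 10, 11, 2]],
       [[16, 21, 20, 12], [22, 12, 20, 9]], [[24, 4, 3, 20], [5, 20, 3, 17]],
       [[3, 8, 24, 7], [9, 7, 24, 21]], [[4, 9, 0, 8], [10, 8, 0, 22]],
       [[10, 17, 12, 23], [0, 15, 23, 12]], [[18, 11, 24, 13], [1, 16, 13, 24]],
       [[18, 0, 6, 20], [8, 23, 20, 6]], [[21, 3, 23, 9], [11, 1, 9, 23]],
       [[22, 4, 24, 10], [12, 2, 10, 24]], [[3, 10, 16, 5], [18, 8, 5, 16]],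
       [[4, 11, 17, 6], [19, 9, 6, 17]], [[13, 18, 17, 9]], [[13, 3, 11, 0]], [[14, 4, 12, 1]],
       [[15, 5, 13, 2]], [[16, 6, 14, 3]], [[20, 10, 18, 7]], [[21, 11, 19, 8]],
       [[23, 13, 21, 10]], [[24, 14, 22, 11]], [[2, 17, 0, 14]], [[6, 21, 4, 18]],
       [[7, 22, 5, 19]]] := by
    decide +kernel
  exact (H.goodDesign (by decide)).mono (by norm_num)

theorem goodDesign_5 : GoodDesign 5 93 := by
  have H : IsDiffFamily (6 * 5 + 1) (6 * 5 + 1) 1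
      [[[25, 0, 12, 29], [5, 0, 25, 8], [12, 0, 5, 27]], [[21, 0, 30, 1], [0, 21, 28, 13]]] := by
    decide +kernel
  exact (H.goodDesign (by decide)).mono (by norm_num)

theorem goodDesign_6 : GoodDesign 6 148 := by
  have H : IsDiffFamily (6 * 6 + 1) (6 * 6 + 1) 1
      [[[2, 0, 22, 12], [14, 0, 2, 21], [22, 0, 14, 3]],
       [[24, 0, 32, 33], [31, 0, 24, 28], [32, 0, 31, 11]]] := by
    decide +kernel
  exact (H.goodDesign (by decide)).mono (by norm_num)

theorem goodDesign_7 : GoodDesign 7 172 := by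
  have H : IsDiffFamily (6 * 7 + 1) (6 * 7 + 1) 1
      [[[18, 0, 31, 5], [23, 0, 18, 27], [31, 0, 23, 42]],
       [[2, 0, 28, 34], [29, 0, 2, 10], [28, 0, 29, 7]], [[0, 39, 33, 36]]] := by
    decide +kernel
  exact (H.goodDesign (by decide)).mono (by norm_num)

theorem goodDesign_8 : GoodDesign 8 245 := by
  have H : IsDiffFamily (6 * 8 + 1) (6 * 8 + 1) 1
      [[[9, 0, 10, 13], [33, 0, 9, 11], [10, 0, 33, 29]],
       [[31, 0, 8, 30], [43, 0, 31, 36], [8, 0, 43, 28]], [[17, 0, 15, 12], [0, 17, 24, 38]]] := by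
    decide +kernel
  exact (H.goodDesign (by decide)).mono (by norm_num)

theorem goodDesign_9 : GoodDesign 9 330 := by
  have H : IsDiffFamily (6 * 9 + 1) (6 * 9 + 1) 1
      [[[41, 0, 37, 47], [21, 0, 41, 48], [37, 0, 21, 15]],
       [[46, 0, 44, 19], [24, 0, 46, 23], [44, 0, 24, 25]],
       [[13, 0, 3, 29], [5, 0, 13, 17], [3, 0, 5, 43]]] := by
    decide +kernel
  exact (H.goodDesign (by decide)).mono (by norm_num)

theorem goodDesign_10 : GoodDesign 10 366 := by
  have H : IsDiffFamily (6 * 10 + 1) (6 * 10 + 1) 1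
      [[[34, 0, 35, 11], [44, 0, 34, 29], [35, 0, 44, 58]],
       [[28, 0, 20, 60], [42, 0, 28, 49], [20, 0, 42, 50]],
       [[55, 0, 25, 18], [16, 0, 55, 59], [25, 0, 16, 12]], [[0, 2, 5, 15]]] := by
    decide +kernel
  exact (H.goodDesign (by decide)).mono (by norm_num)

theorem goodDesign_11 : GoodDesign 11 469 := by
  have H : IsDiffFamily (6 * 11 + 1) (6 * 11 + 1) 1
      [[[54, 0, 3, 2], [8, 0, 54, 60], [3, 0, 8, 35]],
       [[19, 0, 49, 44], [63, 0, 19, 47], [49, 0, 63, 37]],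
       [[17, 0, 57, 11], [58, 0, 17, 24], [57, 0, 58, 29]],
       [[22, 0, 65, 34], [0, 22, 53, 42]]] := by
    decide +kernel
  exact (H.goodDesign (by decide)).mono (by norm_num)

theorem goodDesign_12 : GoodDesign 12 584 := by
  have H : IsDiffFamily (6 * 12 + 1) (6 * 12 + 1) 1
      [[[61, 9, 34, 64], [64, 68, 9, 61], [34, 9, 68, 53]],
       [[44, 25, 42, 68], [3, 36, 42, 25], [68, 42, 36, 5]],
       [[10, 22, 6, 59], [15, 6, 22, 14], [59, 6, 15, 17]],
       [[9, 4, 49, 36], [72, 14, 49, 4], [36, 49, 14, 37]]] := by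
    decide +kernel
  exact (H.goodDesign (by decide)).mono (by norm_num)

theorem goodDesign_13 : GoodDesign 13 632 := by
  have H : IsDiffFamily (6 * 13 + 1) (6 * 13 + 1) 1
      [[[40, 74, 62, 15], [26, 62, 74, 10], [15, 62, 26, 23]],
       [[73, 67, 77, 1], [23, 14, 67, 73], [77, 67, 14, 66]],
       [[34, 75, 10, 27], [52, 10, 75, 34], [60, 27, 10, 52]],
       [[24, 54, 3, 63], [49, 5, 3, 54], [18, 63, 3, 5]], [[40, 41, 18, 36]]] := by
    decide +kernel
  exact (H.goodDesign (by decide)).mono (by norm_num)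

theorem goodDesign_14 : GoodDesign 14 765 := by
  have H : IsDiffFamily (6 * 14 + 1) (6 * 14 + 1) 1
      [[[40, 33, 75, 5], [46, 75, 33, 7], [15, 5, 75, 46]],
       [[33, 15, 19, 84], [10, 15, 33, 59], [19, 15, 10, 73]],
       [[28, 67, 66, 34], [33, 54, 66, 67], [34, 66, 54, 17]],
       [[40, 21, 19, 49], [82, 59, 19, 21], [49, 19, 59, 56]],
       [[34, 23, 50, 26], [23, 34, 48, 42]]] := by
    decide +kernel
  exact (H.goodDesign (by decide)).mono (by norm_num)

theorem goodDesign_15 : GoodDesign 15 910 := by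
  have H : IsDiffFamily (6 * 15 + 1) (6 * 15 + 1) 1
      [[[45, 0, 83, 44], [83, 0, 54, 67], [54, 0, 45, 71]],
       [[67, 11, 0, 85], [71, 85, 0, 86], [44, 86, 0, 11]],
       [[27, 0, 68, 25], [68, 0, 87, 36], [87, 0, 27, 30]],
       [[22, 0, 79, 61], [79, 0, 81, 66], [81, 0, 22, 55]],
       [[31, 28, 0, 84], [41, 84, 0, 70], [19, 70, 0, 28]]] := by
    decide +kernel
  exact (H.goodDesign (by decide)).mono (by norm_num)

theorem goodDesign_26 : GoodDesign 26 2512 := by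
  have H : IsDiffFamily (6 * 26 + 1) (6 * 26 + 1) 1
      [[[49, 0, 117, 12], [117, 0, 148, 144], [148, 0, 49, 1]],
       [[138, 63, 0, 128], [86, 128, 0, 123], [90, 123, 0, 63]],
       [[51, 0, 141, 105], [141, 0, 122, 4], [122, 0, 51, 48]],
       [[8, 0, 96, 13], [96, 0, 53, 156], [53, 0, 8, 145]],
       [[76, 18, 0, 59], [127, 59, 0, 80], [111, 80, 0, 18]],
       [[113, 6, 0, 72], [100, 72, 0, 79], [101, 79, 0, 6]],
       [[25, 0, 143, 101], [143, 0, 146, 113], [146, 0, 25, 100]],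
       [[2, 0, 24, 93], [24, 0, 131, 17], [131, 0, 2, 47]],
       [[0, 15, 38, 70]], [[0, 125, 102, 87]]] := by
    decide +kernel
  exact (H.goodDesign (by decide)).mono (by norm_num)

theorem goodDesign_27 : GoodDesign 27 2934 := by
  have H : IsDiffFamily (6 * 27 + 1) (6 * 27 + 1) 1
      [[[139, 0, 58, 102], [62, 0, 139, 118], [58, 0, 62, 15]],
       [[18, 0, 38, 5], [35, 0, 18, 156], [38, 0, 35, 111]],
       [[68, 0, 53, 37], [96, 0, 68, 46], [53, 0, 96, 39]],
       [[112, 0, 1, 13], [91, 0, 112, 47], [1, 0, 91, 93]],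
       [[79, 0, 40, 31], [54, 0, 79, 87], [40, 0, 54, 134]],
       [[63, 0, 133, 99], [41, 0, 63, 57], [133, 0, 41, 144]],
       [[75, 0, 104, 48], [10, 0, 75, 161], [104, 0, 10, 55]],
       [[66, 0, 85, 127], [74, 0, 66, 83], [85, 0, 74, 81]],
       [[32, 0, 140, 27], [26, 0, 32, 60], [140, 0, 26, 143]]] := by
    decide +kernel
  exact (H.goodDesign (by decide)).mono (by norm_num)

/-- There is a commutative ring of order `m` with four elements whose differences are units. -/
def HasUnitDifferences (m : ℕ) : Prop :=
  ∃ (R : Type) (_ : CommRing R) (_ : Fintype R) (c : Fin 4 → R),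
    Fintype.card R = m ∧ ∀ i j, i ≠ j → IsUnit (c i - c j)

theorem hasUnitDifferences_card (F : Type) [Field F] [Fintype F] (h : 4 ≤ Fintype.card F) :
    HasUnitDifferences (Fintype.card F) := by
  obtain ⟨c⟩ : Nonempty (Fin 4 ↪ F) := Function.Embedding.nonempty_of_card_le (by simpa using h)
  exact ⟨F, inferInstance, inferInstance, c, rfl, fun i j hij =>
    (sub_ne_zero.2 (c.injective.ne hij)).isUnit⟩

theorem hasUnitDifferences_prime_pow (p n : ℕ) [Fact p.Prime] (hn : n ≠ 0) (h : 4 ≤ p ^ n) :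
    HasUnitDifferences (p ^ n) := by
  have := Fintype.ofFinite (GaloisField p n)
  have hc : Fintype.card (GaloisField p n) = p ^ n := by
    rw [← Nat.card_eq_fintype_card, GaloisField.card p n hn]
  exact hc ▸ hasUnitDifferences_card (GaloisField p n) (hc ▸ h)

theorem hasUnitDifferences_of_coprime {m : ℕ} (h : m.Coprime 6) : HasUnitDifferences m := by
  have : NeZero m := ⟨by rintro rfl; simp at h⟩
  have h2 : IsUnit (2 : ZMod m) := by
    exact_mod_cast (ZMod.isUnit_iff_coprime 2 m).2 (h.symm.coprime_dvd_left (by norm_num))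
  have h3 : IsUnit (3 : ZMod m) := by
    exact_mod_cast (ZMod.isUnit_iff_coprime 3 m).2 (h.symm.coprime_dvd_left (by norm_num))
  refine ⟨ZMod m, inferInstance, inferInstance, ![0, 1, 2, 3], ZMod.card m, ?_⟩
  intro i j hij
  fin_cases i <;> fin_cases j <;> first | exact absurd rfl hij | skip
  all_goals norm_num [h2, h3]

theorem GoodDesign.four_mul_add {m u : ℕ} {s t : ℚ} (hm : HasUnitDifferences m) (hu : u ≤ m)
    (hs : GoodDesign m s) (ht : GoodDesign u t) :
    GoodDesign (4 * m + u) (m * ((m - u) * 48 + u * 75) + (4 * s + t)) := by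
  obtain ⟨R, _, _, c, rfl, hc⟩ := hm
  obtain ⟨U, -, rfl⟩ := Finset.exists_subset_card_eq (s := (Finset.univ : Finset R)) hu
  refine GoodDesign.of_card (good_offDiag_transversal (κ := Fin 6) c hc U
    good_transversal_four good_transversal_five (hs.to_card ?_) (ht.to_card ?_)) ?_
  all_goals simp
  all_goals ring

/-- The number of blocks forced by the designs constructed on `6 * k + 1` points, which is
`(5 / 8 - 13 / (8 * v)) * (v * (v - 1) / 6)` for `v = 6 * k + 1` with three exceptions. -/
def forcedBlocks (k : ℕ) : ℚ :=
  (15 * k ^ 2 - 4 * k) / 4 - if k = 1 then 11 / 4 else if k = 4 then 6 else if k = 7 then 19 / 4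
    else 0

theorem goodDesign_19 : GoodDesign 19 1335 :=
  (GoodDesign.four_mul_add (hasUnitDifferences_prime_pow 2 2 (by norm_num) (by norm_num))
    (by norm_num) goodDesign_4 goodDesign_3).mono (by norm_num)

theorem goodDesign_zero : GoodDesign 0 0 := by
  refine GoodDesign.of_card (α := Unit) ?_ rfl
  convert good_empty
  ext
  simp

theorem goodDesign_forcedBlocks_of_le {k : ℕ} (hk : k ≤ 15) : GoodDesign k (forcedBlocks k) := by
  interval_cases k
  · exact goodDesign_zero.mono (by norm_num [forcedBlocks])
  · exact goodDesign_1.mono (by norm_num [forcedBlocks])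
  · exact goodDesign_2.mono (by norm_num [forcedBlocks])
  · exact goodDesign_3.mono (by norm_num [forcedBlocks])
  · exact goodDesign_4.mono (by norm_num [forcedBlocks])
  · exact goodDesign_5.mono (by norm_num [forcedBlocks])
  · exact goodDesign_6.mono (by norm_num [forcedBlocks])
  · exact goodDesign_7.mono (by norm_num [forcedBlocks])
  · exact goodDesign_8.mono (by norm_num [forcedBlocks])
  · exact goodDesign_9.mono (by norm_num [forcedBlocks])
  · exact goodDesign_10.mono (by norm_num [forcedBlocks])
  · exact goodDesign_11.mono (by norm_num [forcedBlocks])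
  · exact goodDesign_12.mono (by norm_num [forcedBlocks])
  · exact goodDesign_13.mono (by norm_num [forcedBlocks])
  · exact goodDesign_14.mono (by norm_num [forcedBlocks])
  · exact goodDesign_15.mono (by norm_num [forcedBlocks])

theorem exists_four_mul_add {k : ℕ} (hk : 16 ≤ k) (h19 : k ≠ 19) (h26 : k ≠ 26) (h27 : k ≠ 27) :
    ∃ m u, k = 4 * m + u ∧ 4 ≤ m ∧ u ≤ m ∧ (m = 4 → u ≤ 2) ∧ (m = 7 → u ≤ 6) ∧
      (m = 4 ∨ m = 8 ∨ m = 9 ∨ m = 16 ∨ m % 6 = 1 ∨ m % 6 = 5) := by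
  have key : ∀ m, 4 * m ≤ k → k ≤ 5 * m → 4 ≤ m → (m = 4 → k ≤ 18) → (m = 7 → k ≤ 34) →
      (m = 4 ∨ m = 8 ∨ m = 9 ∨ m = 16 ∨ m % 6 = 1 ∨ m % 6 = 5) →
      ∃ m u, k = 4 * m + u ∧ 4 ≤ m ∧ u ≤ m ∧ (m = 4 → u ≤ 2) ∧ (m = 7 → u ≤ 6) ∧
        (m = 4 ∨ m = 8 ∨ m = 9 ∨ m = 16 ∨ m % 6 = 1 ∨ m % 6 = 5) := fun m h1 h2 h3 h4 h5 h6 =>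
    ⟨m, k - 4 * m, by omega, h3, by omega, by omega, by omega, h6⟩
  by_cases h : k < 76
  · have : k ≤ 18 ∨ (20 ≤ k ∧ k ≤ 25) ∨ (28 ≤ k ∧ k ≤ 34) ∨ k = 35 ∨ (36 ≤ k ∧ k ≤ 44) ∨
        (45 ≤ k ∧ k ≤ 55) ∨ (56 ≤ k ∧ k ≤ 65) ∨ 66 ≤ k := by omega
    rcases this with h | h | h | h | h | h | h | h
    · exact key 4 (by omega) (by omega) (by omega) (by omega) (by omega) (by omega)
    · exact key 5 (by omega) (by omega) (by omega) (by omega) (by omega) (by omega)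
    · exact key 7 (by omega) (by omega) (by omega) (by omega) (by omega) (by omega)
    · exact key 8 (by omega) (by omega) (by omega) (by omega) (by omega) (by omega)
    · exact key 9 (by omega) (by omega) (by omega) (by omega) (by omega) (by omega)
    · exact key 11 (by omega) (by omega) (by omega) (by omega) (by omega) (by omega)
    · exact key 13 (by omega) (by omega) (by omega) (by omega) (by omega) (by omega)
    · exact key 16 (by omega) (by omega) (by omega) (by omega) (by omega) (by omega)
  · obtain ⟨m, h1, h2, h3⟩ : ∃ m, 4 * m ≤ k ∧ k ≤ 5 * m ∧ (m % 6 = 1 ∨ m % 6 = 5) := by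
      have h6 : ∃ i < 4, ((k + 4) / 5 + i) % 6 = 1 ∨ ((k + 4) / 5 + i) % 6 = 5 := by
        have : (k + 4) / 5 % 6 < 6 := Nat.mod_lt _ (by norm_num)
        interval_cases hr : (k + 4) / 5 % 6
        · exact ⟨1, by omega⟩
        · exact ⟨0, by omega⟩
        · exact ⟨3, by omega⟩
        · exact ⟨2, by omega⟩
        · exact ⟨1, by omega⟩
        · exact ⟨0, by omega⟩
      obtain ⟨i, hi, hi'⟩ := h6
      exact ⟨(k + 4) / 5 + i, by omega, by omega, hi'⟩
    exact key m h1 h2 (by omega) (by omega) (by omega) (by omega)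

theorem forcedBlocks_four_mul_add_le {m u : ℕ} (hm : 4 ≤ m) (hu : u ≤ m) (h4 : m = 4 → u ≤ 2)
    (h7 : m = 7 → u ≤ 6) : forcedBlocks (4 * m + u) ≤
      m * ((m - u) * 48 + u * 75) + (4 * forcedBlocks m + forcedBlocks u) := by
  have h0 : forcedBlocks (4 * m + u) = (15 * (4 * m + u) ^ 2 - 4 * (4 * m + u)) / 4 := by
    rw [forcedBlocks, if_neg (by omega), if_neg (by omega), if_neg (by omega)]
    push_cast
    ring
  rw [h0]
  have hu' : (u : ℚ) ≤ m := by exact_mod_cast hu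
  have hm' : (0 : ℚ) ≤ m := by positivity
  by_cases h : m = 4
  · subst h
    have := h4 rfl
    interval_cases u <;> norm_num [forcedBlocks]
  by_cases h : m = 7
  · subst h
    have := h7 rfl
    interval_cases u <;> norm_num [forcedBlocks]
  have e : forcedBlocks m = (15 * m ^ 2 - 4 * m) / 4 := by
    rw [forcedBlocks, if_neg (by omega), if_neg (by omega), if_neg (by omega), sub_zero]
  rw [e]
  by_cases hum : u = m
  · rw [hum, e]
    linarith
  · have h1 : (u : ℚ) + 1 ≤ m := by exact_mod_cast Nat.lt_of_le_of_ne hu hum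
    have h5 : (5 : ℚ) ≤ m := by exact_mod_cast (show 5 ≤ m by omega)
    have : (15 * (u : ℚ) ^ 2 - 4 * u) / 4 - 6 ≤ forcedBlocks u := by
      rw [forcedBlocks]
      split_ifs <;> linarith
    nlinarith

theorem goodDesign_forcedBlocks (k : ℕ) : GoodDesign k (forcedBlocks k) := by
  induction k using Nat.strong_induction_on with
  | _ k ih =>
    by_cases hk : k ≤ 15
    · exact goodDesign_forcedBlocks_of_le hk
    by_cases h19 : k = 19
    · exact h19 ▸ goodDesign_19.mono (by norm_num [forcedBlocks])
    by_cases h26 : k = 26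
    · exact h26 ▸ goodDesign_26.mono (by norm_num [forcedBlocks])
    by_cases h27 : k = 27
    · exact h27 ▸ goodDesign_27.mono (by norm_num [forcedBlocks])
    obtain ⟨m, u, rfl, hm, hu, h4, h7, h⟩ := exists_four_mul_add (by omega) h19 h26 h27
    have hc : HasUnitDifferences m := by
      rcases h with rfl | rfl | rfl | rfl | h
      · exact hasUnitDifferences_prime_pow 2 2 (by norm_num) (by norm_num)
      · exact hasUnitDifferences_prime_pow 2 3 (by norm_num) (by norm_num)
      · exact hasUnitDifferences_prime_pow 3 2 (by norm_num) (by norm_num)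
      · exact hasUnitDifferences_prime_pow 2 4 (by norm_num) (by norm_num)
      · have h6 : Nat.gcd 6 m = Nat.gcd (m % 6) 6 := Nat.gcd_rec 6 m
        refine hasUnitDifferences_of_coprime (Nat.Coprime.symm ?_)
        rcases h with h | h <;> simp [Nat.Coprime, h6, h]
    exact (GoodDesign.four_mul_add hc hu (ih m (by omega)) (ih u (by omega))).mono
      (forcedBlocks_four_mul_add_le hm hu h4 h7)

/-- For every `v ≥ 61` with `v ≡ 1 (mod 12)` there is a
`2-(v,4,1)DD` (with `v(v-1)/6` blocks) whose every defining set contains at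
least `(5/8 - 13/(8v))·(v(v-1)/6)` blocks. -/
theorem stmt7 (v : ℕ) (hv : 61 ≤ v) (hmod : v % 12 = 1) :
    ∃ B : Multiset (List (Fin v)),
      IsDD 2 4 1 B ∧
      (Multiset.card B : ℝ) = (v : ℝ) * ((v : ℝ) - 1) / 6 ∧
      ∀ S : Multiset (List (Fin v)), IsDefiningSet 2 4 1 B S →
        (5 / 8 - 13 / (8 * (v : ℝ))) * ((v : ℝ) * ((v : ℝ) - 1) / 6)
          ≤ (Multiset.card S : ℝ) := by
  obtain ⟨k, rfl⟩ : ∃ k, v = 6 * k + 1 := ⟨v / 6, by omega⟩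
  obtain ⟨B, hB, hcard, hS⟩ := (goodDesign_forcedBlocks k).exists_isDD
  refine ⟨B, hB, ?_, fun S h => ?_⟩
  · have h1 : 6 * Multiset.card B + (6 * k + 1) = (6 * k + 1) * (6 * k + 1) := by
      rw [hcard, Fintype.card_fin, Nat.sub_add_cancel (Nat.le_mul_self _)]
    have h2 : (6 * Multiset.card B + (6 * k + 1) : ℝ) = (6 * k + 1) * (6 * k + 1) := by
      exact_mod_cast h1
    push_cast
    linarith
  · have h1 : ((forcedBlocks k : ℚ) : ℝ) ≤ (Multiset.card S : ℝ) := by exact_mod_cast hS S h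
    refine le_trans (le_of_eq ?_) h1
    rw [forcedBlocks, if_neg (by omega), if_neg (by omega), if_neg (by omega)]
    push_cast
    field_simp
    ring
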